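/- Let Y be a real Banach space. If the pair (ℓ∞⁴, Y) has the Bishop–Phelps–Bollobás property for operators with a function η, then Y has the approximate hyperplane sum property for ℓ∞⁴ with the function γ(ε) = η(ε/48). -/

import Mathlib

/-- `M_Y^4`: quadruples `(y₁,y₂,y₃,y₄)` in the closed unit ball of `Y` such that
`‖y_{i₁} − y_{i₂} + y_{i₃}‖ ≤ 1` for all `i₁ < i₂ < i₃`. -/
def MY4 {Y : Type*} [NormedAddCommGroup Y] (y : Fin 4 → Y) : Prop :=
  (∀ i, ‖y i‖ ≤ 1) ∧
    ∀ i j k : Fin 4, i < j → j < k → ‖y i - y j + y k‖ ≤ 1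

/-- `Y` has the approximate hyperplane sum property for `ℓ∞⁴` with the function `γ`. -/
def AHSpL4With (Y : Type*) [NormedAddCommGroup Y] [NormedSpace ℝ Y] (γ : ℝ → ℝ) : Prop :=
  ∀ ε : ℝ, 0 < ε → ε < 1 →
    (0 < γ ε ∧ γ ε < ε) ∧
    ∀ y : Fin 4 → Y, MY4 y →
      ∀ A : Finset (Fin 4), A.Nonempty →
        ∀ f : Y →L[ℝ] ℝ, ‖f‖ = 1 →
          (∀ i ∈ A, 1 - γ ε < f (y i)) →
          ∃ z : Fin 4 → Y, MY4 z ∧ (∀ i, ‖z i - y i‖ < ε) ∧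
            ‖∑ i ∈ A, z i‖ = (A.card : ℝ)

/-- The pair `(X, Y)` has the Bishop–Phelps–Bollobás property for operators with function `η`. -/
def BPBpWith (X Y : Type*) [NormedAddCommGroup X] [NormedSpace ℝ X]
    [NormedAddCommGroup Y] [NormedSpace ℝ Y] (η : ℝ → ℝ) : Prop :=
  ∀ ε : ℝ, 0 < ε → ε < 1 →
    (0 < η ε ∧ η ε < ε) ∧
    ∀ T : X →L[ℝ] Y, ‖T‖ = 1 → ∀ x₀ : X, ‖x₀‖ = 1 → 1 - η ε < ‖T x₀‖ →
      ∃ u₀ : X, ‖u₀‖ = 1 ∧ ∃ S : X →L[ℝ] Y, ‖S‖ = 1 ∧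
        ‖S u₀‖ = 1 ∧ ‖u₀ - x₀‖ < ε ∧ ‖S - T‖ < ε

/-- The sign vectors `(1,1,1,1)`, `(-1,1,1,1)`, `(-1,-1,1,1)`, `(-1,-1,-1,1)`. -/
def signVec (i k : Fin 4) : ℤ := if k < i then -1 else 1

/-- The sign vectors `signVec i`, as elements of `ℓ∞⁴`. -/
def realSignVec (i k : Fin 4) : ℝ := signVec i k

lemma norm_realSignVec_le (i : Fin 4) : ‖realSignVec i‖ ≤ 1 := by
  refine (pi_norm_le_iff_of_nonneg zero_le_one).2 fun k => ?_
  have h : ∀ i k : Fin 4, |signVec i k| ≤ 1 := by decide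
  rw [Real.norm_eq_abs, realSignVec]
  exact_mod_cast h i k

lemma norm_realSignVec_sub_add_le {i j k : Fin 4} (hij : i < j) (hjk : j < k) :
    ‖realSignVec i - realSignVec j + realSignVec k‖ ≤ 1 := by
  refine (pi_norm_le_iff_of_nonneg zero_le_one).2 fun l => ?_
  have h : ∀ i j k l : Fin 4, i < j → j < k →
      |signVec i l - signVec j l + signVec k l| ≤ 1 := by decide
  simp only [Real.norm_eq_abs, Pi.add_apply, Pi.sub_apply, realSignVec]
  exact_mod_cast h i j k l hij hjk

lemma sum_signVec_eq_or_two_mul_abs_le :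
    ∀ A : Finset (Fin 4), ∀ i ∈ A, ∀ k, (∑ j ∈ A, signVec j k = A.card * signVec i k) ∨
      2 * |∑ j ∈ A, signVec j k| ≤ A.card := by
  decide

/-- The average of the sign vectors with index in `A`. -/
noncomputable def avgSignVec (A : Finset (Fin 4)) : Fin 4 → ℝ :=
  (A.card : ℝ)⁻¹ • ∑ i ∈ A, realSignVec i

lemma avgSignVec_eq_or_abs_le {A : Finset (Fin 4)} {i : Fin 4} (hi : i ∈ A) (k : Fin 4) :
    avgSignVec A k = realSignVec i k ∨ |avgSignVec A k| ≤ 1 / 2 := by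
  have hA : (0 : ℝ) < A.card := by exact_mod_cast Finset.card_pos.2 ⟨i, hi⟩
  have havg : avgSignVec A k = (A.card : ℝ)⁻¹ * ((∑ j ∈ A, signVec j k : ℤ) : ℝ) := by
    simp [avgSignVec, realSignVec]
  rw [havg]
  rcases sum_signVec_eq_or_two_mul_abs_le A i hi k with h | h
  · left
    rw [h, realSignVec]
    push_cast
    field_simp
  · right
    have h' : 2 * |((∑ j ∈ A, signVec j k : ℤ) : ℝ)| ≤ A.card := by exact_mod_cast h
    rw [abs_mul, abs_inv, abs_of_pos hA, inv_mul_le_iff₀ hA]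
    linarith

lemma norm_avgSignVec {A : Finset (Fin 4)} (hA : A.Nonempty) : ‖avgSignVec A‖ = 1 := by
  have hc : (0 : ℝ) < A.card := by exact_mod_cast hA.card_pos
  apply le_antisymm
  · rw [avgSignVec, norm_smul, norm_inv, Real.norm_of_nonneg hc.le, inv_mul_le_iff₀ hc]
    calc ‖∑ i ∈ A, realSignVec i‖ ≤ ∑ i ∈ A, ‖realSignVec i‖ := norm_sum_le _ _
      _ ≤ ∑ _i ∈ A, (1 : ℝ) := Finset.sum_le_sum fun i _ => norm_realSignVec_le i
      _ = A.card * 1 := by simp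
  · have h3 : avgSignVec A 3 = 1 := by
      have h : ∀ i : Fin 4, signVec i 3 = 1 := by decide
      simp [avgSignVec, realSignVec, h, hc.ne']
    simpa [h3] using norm_le_pi_norm (avgSignVec A) 3

/-- A functional of norm at most one that equals one at a point of the unit ball close to
`avgSignVec A` equals one at every sign vector with index in `A`. -/
lemma apply_realSignVec_eq_one {A : Finset (Fin 4)} {i : Fin 4} (hi : i ∈ A)
    {g : (Fin 4 → ℝ) →L[ℝ] ℝ} (hg : ‖g‖ ≤ 1) {u : Fin 4 → ℝ} (hu : ‖u‖ = 1) (hgu : g u = 1)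
    (hclose : ‖u - avgSignVec A‖ ≤ 1 / 48) : g (realSignVec i) = 1 := by
  have hle : ∀ x, ‖x‖ ≤ 1 → g x ≤ 1 := fun x hx =>
    (le_abs_self _).trans (g.le_of_opNorm_le_of_le hg hx |>.trans (by norm_num))
  refine le_antisymm (hle _ (norm_realSignVec_le i)) ?_
  have hnorm : ‖u - (1 / 8 : ℝ) • (realSignVec i - u)‖ ≤ 1 := by
    refine (pi_norm_le_iff_of_nonneg zero_le_one).2 fun k => ?_
    have h1 := (norm_le_pi_norm u k).trans hu.le
    have h2 := (norm_le_pi_norm (u - avgSignVec A) k).trans hclose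
    have h3 : realSignVec i k = -1 ∨ realSignVec i k = 1 := by
      rw [realSignVec, signVec]
      split_ifs <;> simp
    simp only [Pi.sub_apply, Pi.smul_apply, smul_eq_mul, Real.norm_eq_abs, abs_le] at *
    rcases avgSignVec_eq_or_abs_le hi k with h | h
    · rw [h] at h2
      rcases h3 with h3 | h3 <;> rw [h3] at h2 ⊢ <;> constructor <;> linarith
    · rw [abs_le] at h
      rcases h3 with h3 | h3 <;> rw [h3] <;> constructor <;> linarith
  have h := hle _ hnorm
  simp only [map_sub, map_smul, smul_eq_mul, hgu] at h
  linarith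

section

variable {Y : Type*} [NormedAddCommGroup Y] [NormedSpace ℝ Y]

lemma MY4_apply_realSignVec {S : (Fin 4 → ℝ) →L[ℝ] Y} (hS : ‖S‖ ≤ 1) :
    MY4 fun i => S (realSignVec i) := by
  have hle : ∀ x, ‖x‖ ≤ 1 → ‖S x‖ ≤ 1 := fun x hx => by
    simpa using S.le_of_opNorm_le_of_le hS hx
  refine ⟨fun i => hle _ (norm_realSignVec_le i), fun i j k hij hjk => ?_⟩
  rw [← map_sub, ← map_add]
  exact hle _ (norm_realSignVec_sub_add_le hij hjk)

lemma sum_abs_le_two_of_abs_sub_add_le {a b c d : ℝ} (ha : |a| ≤ 1) (hb : |b| ≤ 1) (hc : |c| ≤ 1)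
    (hd : |d| ≤ 1) (habc : |a - b + c| ≤ 1) (habd : |a - b + d| ≤ 1) (hacd : |a - c + d| ≤ 1)
    (hbcd : |b - c + d| ≤ 1) : |a - b| + |b - c| + |c - d| + |a + d| ≤ 2 := by
  rw [abs_le] at *
  rcases abs_cases (a - b) with ⟨h1, -⟩ | ⟨h1, -⟩ <;>
  rcases abs_cases (b - c) with ⟨h2, -⟩ | ⟨h2, -⟩ <;>
  rcases abs_cases (c - d) with ⟨h3, -⟩ | ⟨h3, -⟩ <;>
  rcases abs_cases (a + d) with ⟨h4, -⟩ | ⟨h4, -⟩ <;>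
  rw [h1, h2, h3, h4] <;> linarith

/-- A quadruple in `M_Y^4` is the image of the sign vectors under an operator of norm at most
one. -/
lemma MY4.exists_clm {y : Fin 4 → Y} (hy : MY4 y) :
    ∃ T : (Fin 4 → ℝ) →L[ℝ] Y, ‖T‖ ≤ 1 ∧ ∀ i, T (realSignVec i) = y i := by
  let P (k : Fin 4) : (Fin 4 → ℝ) →L[ℝ] ℝ := ContinuousLinearMap.proj k
  let T : (Fin 4 → ℝ) →L[ℝ] Y := (1 / 2 : ℝ) • ((P 0).smulRight (y 0 - y 1) +
    (P 1).smulRight (y 1 - y 2) + (P 2).smulRight (y 2 - y 3) + (P 3).smulRight (y 0 + y 3))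
  have hT (x : Fin 4 → ℝ) : T x = (1 / 2 : ℝ) • (x 0 • (y 0 - y 1) + x 1 • (y 1 - y 2) +
    x 2 • (y 2 - y 3) + x 3 • (y 0 + y 3)) := rfl
  refine ⟨T, T.opNorm_le_bound zero_le_one fun x => ?_, fun i => ?_⟩
  · obtain ⟨f, hf, hfx⟩ := exists_dual_vector'' ℝ (T x)
    have hle (v : Y) (hv : ‖v‖ ≤ 1) : |f v| ≤ 1 := by
      simpa using f.le_of_opNorm_le_of_le hf hv
    have h012 := hle _ (hy.2 0 1 2 (by decide) (by decide))
    have h013 := hle _ (hy.2 0 1 3 (by decide) (by decide))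
    have h023 := hle _ (hy.2 0 2 3 (by decide) (by decide))
    have h123 := hle _ (hy.2 1 2 3 (by decide) (by decide))
    simp only [map_add, map_sub] at h012 h013 h023 h123
    have hsum := sum_abs_le_two_of_abs_sub_add_le (hle _ (hy.1 0)) (hle _ (hy.1 1))
      (hle _ (hy.1 2)) (hle _ (hy.1 3)) h012 h013 h023 h123
    have hmul (k : Fin 4) (r : ℝ) : x k * r ≤ ‖x‖ * |r| :=
      (le_abs_self _).trans ((abs_mul _ _).trans_le
        (mul_le_mul_of_nonneg_right (norm_le_pi_norm x k) (abs_nonneg r)))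
    have hTx : ‖T x‖ = f (T x) := by simpa using hfx.symm
    rw [hTx, hT]
    simp only [map_add, map_sub, map_smul, smul_eq_mul]
    have h0 := hmul 0 (f (y 0) - f (y 1))
    have h1 := hmul 1 (f (y 1) - f (y 2))
    have h2 := hmul 2 (f (y 2) - f (y 3))
    have h3 := hmul 3 (f (y 0) + f (y 3))
    have := mul_le_mul_of_nonneg_left hsum (norm_nonneg x)
    linarith
  · rw [hT]
    fin_cases i <;> simp [realSignVec, signVec] <;> module

end

/-- If `(ℓ∞⁴, Y)` has the BPBp with function `η`, then `Y` has the AHSp-`ℓ∞⁴`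
with the function `γ(ε) = η(ε/48)`.  (`Fin 4 → ℝ` carries the sup norm, i.e. it is `ℓ∞⁴`.) -/
theorem stmt0 (Y : Type*) [NormedAddCommGroup Y] [NormedSpace ℝ Y] [CompleteSpace Y]
    (η : ℝ → ℝ) (h : BPBpWith (Fin 4 → ℝ) Y η) :
    AHSpL4With Y (fun ε => η (ε / 48)) := by
  intro ε hε hε1
  obtain ⟨⟨hη, hηε⟩, hB⟩ := h (ε / 48) (by linarith) (by linarith)
  refine ⟨⟨hη, by dsimp only; linarith⟩, fun y hy A hA f hf hfy => ?_⟩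
  obtain ⟨T, hT1, hTy⟩ := hy.exists_clm
  have hc : (0 : ℝ) < A.card := by exact_mod_cast hA.card_pos
  have hx₀ := norm_avgSignVec hA
  have hTx₀ : 1 - η (ε / 48) < ‖T (avgSignVec A)‖ := by
    have h1 : f (T (avgSignVec A)) ≤ ‖T (avgSignVec A)‖ := by
      simpa [hf] using (le_abs_self _).trans (f.le_opNorm (T (avgSignVec A)))
    refine lt_of_lt_of_le ?_ h1
    simp only [avgSignVec, map_smul, map_sum, hTy, smul_eq_mul]
    rw [lt_inv_mul_iff₀ hc, ← nsmul_eq_mul, ← Finset.sum_const]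
    exact Finset.sum_lt_sum_of_nonempty hA hfy
  have hTnorm : 1 - η (ε / 48) < ‖T‖ :=
    hTx₀.trans_le (by simpa [hx₀] using T.le_opNorm (avgSignVec A))
  have hTpos : 0 < ‖T‖ := by linarith
  have hT'norm : ‖‖T‖⁻¹ • T‖ = 1 := by
    rw [norm_smul, norm_inv, norm_norm, inv_mul_cancel₀ hTpos.ne']
  have hTT' : ‖‖T‖⁻¹ • T - T‖ < ε / 48 := by
    have : ‖T‖⁻¹ • T - T = (1 - ‖T‖) • (‖T‖⁻¹ • T) := by
      ext1 x
      simp [sub_mul, sub_smul, smul_smul, hTpos.ne']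
    rw [this, norm_smul, hT'norm, Real.norm_of_nonneg (by linarith)]
    linarith
  obtain ⟨u, hu, S, hS, hSu, hux, hST⟩ := hB (‖T‖⁻¹ • T) hT'norm (avgSignVec A) hx₀ <| by
    refine hTx₀.trans_le ?_
    rw [smul_apply, norm_smul, norm_inv, norm_norm]
    exact le_mul_of_one_le_left (norm_nonneg _) ((one_le_inv₀ hTpos).2 hT1)
  refine ⟨fun i => S (realSignVec i), MY4_apply_realSignVec hS.le, fun i => ?_, ?_⟩
  · have hdist : ‖S - T‖ < ε := by
      have := norm_sub_le_norm_sub_add_norm_sub S (‖T‖⁻¹ • T) T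
      linarith
    rw [← hTy i, ← sub_apply]
    exact lt_of_le_of_lt (by
      simpa using (S - T).le_of_opNorm_le_of_le le_rfl (norm_realSignVec_le i)) hdist
  · apply le_antisymm
    · calc ‖∑ i ∈ A, S (realSignVec i)‖ ≤ ∑ i ∈ A, ‖S (realSignVec i)‖ := norm_sum_le _ _
        _ ≤ ∑ _i ∈ A, (1 : ℝ) :=
          Finset.sum_le_sum fun i _ => (MY4_apply_realSignVec hS.le).1 i
        _ = A.card := by simp
    · obtain ⟨φ, hφ, hφu⟩ := exists_dual_vector'' ℝ (S u)
      have hg : ‖φ.comp S‖ ≤ 1 := by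
        have := φ.opNorm_comp_le S
        rw [hS, mul_one] at this
        exact this.trans hφ
      have hφA : φ (∑ i ∈ A, S (realSignVec i)) = A.card := by
        have hone : ∀ i ∈ A, φ (S (realSignVec i)) = 1 := fun i hi =>
          apply_realSignVec_eq_one hi hg hu (by simpa [hSu] using hφu) (by linarith)
        simp [map_sum, Finset.sum_congr rfl hone]
      rw [← hφA]
      simpa using (le_abs_self _).trans (φ.le_of_opNorm_le hφ (∑ i ∈ A, S (realSignVec i)))
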